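/- For every integer m ≥ 2 and every integer i with 1 ≤ i ≤ m−1, one has d_i(m)^2 / (d_{i-1}(m) · d_{i+1}(m)) > (i+1)/i; equivalently, the sequence {i! · d_i(m)}_{0≤i≤m} is strictly log-concave, i.e. (i! · d_i(m))^2 > ((i−1)! · d_{i-1}(m)) · ((i+1)! · d_{i+1}(m)) for 1 ≤ i ≤ m−1. -/

import Mathlib

/-- The Boros-Moll coefficient `d_i(m)`, as a real number:
`d_i(m) = 4^(-m) * sum_{k=0}^m 2^k * C(2m-2k, m-k) * C(m+k, m) * C(k, i)`. -/
noncomputable def d (m i : ℕ) : ℝ :=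
  (∑ k ∈ Finset.range (m + 1),
      (2 : ℝ) ^ k * (Nat.choose (2 * m - 2 * k) (m - k) : ℝ) *
        (Nat.choose (m + k) m : ℝ) * (Nat.choose k i : ℝ)) / 4 ^ m

/-- The falling factorial, cast to the reals, satisfies its recursion without truncation. -/
lemma cast_descFactorial_succ_eq (k j : ℕ) :
    (k.descFactorial (j + 1) : ℝ) = ((k : ℝ) - j) * k.descFactorial j := by
  rcases le_or_gt j k with h | h
  · rw [Nat.descFactorial_succ, Nat.cast_mul, Nat.cast_sub h]
  · rw [Nat.descFactorial_of_lt h, Nat.descFactorial_of_lt (h.trans (Nat.lt_succ_self j))]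
    simp

/-- The coefficient of `(x + 1) ^ k` in `4 ^ m` times the Boros-Moll polynomial. -/
noncomputable def borosMollWeight (m k : ℕ) : ℝ :=
  (2 : ℝ) ^ k * (Nat.choose (2 * m - 2 * k) (m - k) : ℝ) * (Nat.choose (m + k) m : ℝ)

lemma borosMollWeight_succ {m k : ℕ} (hk : k < m) :
    borosMollWeight m (k + 1) * (k + 1) * (2 * m - 2 * k - 1) =
      (m - k) * (m + k + 1) * borosMollWeight m k := by
  obtain ⟨n, rfl⟩ : ∃ n, m = k + 1 + n := ⟨m - (k + 1), by omega⟩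
  have h1 := Nat.succ_mul_centralBinom_succ n
  have h2 := Nat.add_one_mul_choose_eq (k + 1 + n + k) k
  have e1 : 2 * (k + 1 + n) - 2 * (k + 1) = 2 * n := by omega
  have e2 : k + 1 + n - (k + 1) = n := by omega
  have e3 : 2 * (k + 1 + n) - 2 * k = 2 * (n + 1) := by omega
  have e4 : k + 1 + n - k = n + 1 := by omega
  have e5 : (k + 1 + n + (k + 1)).choose (k + 1 + n) = (k + 1 + n + k + 1).choose (k + 1) :=
    Nat.choose_symm_add
  have e6 : (k + 1 + n + k).choose (k + 1 + n) = (k + 1 + n + k).choose k :=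
    Nat.choose_symm_add
  rw [borosMollWeight, borosMollWeight, e1, e2, e3, e4, e5, e6, ← Nat.centralBinom,
    ← Nat.centralBinom]
  have h1' : ((n : ℝ) + 1) * (n + 1).centralBinom = 2 * (2 * n + 1) * n.centralBinom := by
    exact_mod_cast h1
  have h2' : ((k : ℝ) + 1 + n + k + 1) * (k + 1 + n + k).choose k =
      (k + 1 + n + k + 1).choose (k + 1) * (k + 1) := by
    exact_mod_cast h2
  push_cast
  rw [pow_succ]
  linear_combination (-(2 : ℝ) ^ k * 2 * n.centralBinom * (2 * n + 1)) * h2' -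
    (2 : ℝ) ^ k * (k + 1 + n + k + 1) * (k + 1 + n + k).choose k * h1'

lemma factorial_mul_d (m i : ℕ) :
    (i.factorial : ℝ) * d m i =
      (∑ k ∈ Finset.range (m + 1), borosMollWeight m k * k.descFactorial i) / 4 ^ m := by
  rw [d, mul_div_assoc', Finset.mul_sum]
  congr 1
  refine Finset.sum_congr rfl fun k _ => ?_
  rw [Nat.descFactorial_eq_factorial_mul_choose, borosMollWeight]
  push_cast
  ring

lemma sum_borosMollWeight_mul (m j : ℕ) {n : ℕ} (hn : n ≤ m) :
    ∑ k ∈ Finset.range (n + 1), borosMollWeight m k *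
        (((m : ℝ) - j) * (m + j + 1) * k.descFactorial j + k.descFactorial (j + 2) -
          (2 * m + 1) * k.descFactorial (j + 1)) =
      (m - n) * (m + n + 1) * borosMollWeight m n * n.descFactorial j := by
  induction n with
  | zero =>
    cases j <;> simp
    ring
  | succ n ih =>
    rw [Finset.sum_range_succ, ih (by omega), ← borosMollWeight_succ (by omega)]
    have h1 : (((n + 1).descFactorial (j + 1) : ℕ) : ℝ) = (n + 1) * n.descFactorial j := by
      rw [Nat.succ_descFactorial_succ]
      push_cast
      ring
    have h2 := cast_descFactorial_succ_eq (n + 1) j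
    have h3 := cast_descFactorial_succ_eq (n + 1) (j + 1)
    push_cast at h2 h3 ⊢
    rw [h3]
    linear_combination (-borosMollWeight m (n + 1) * (2 * m - 2 * n - 1)) * h1 +
      borosMollWeight m (n + 1) * (n - j - (2 * m + 1) + (2 * m - 2 * n - 1)) * h2

/-- The three-term recurrence in `i` for the sequence `i! * d m i`. -/
lemma factorial_mul_d_recurrence (m j : ℕ) :
    ((m : ℝ) - j) * (m + j + 1) * (j.factorial * d m j) +
        (j + 2).factorial * d m (j + 2) =
      (2 * m + 1) * ((j + 1).factorial * d m (j + 1)) := by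
  have h := sum_borosMollWeight_mul m j le_rfl
  simp only [mul_sub, mul_add, Finset.sum_sub_distrib, Finset.sum_add_distrib,
    mul_left_comm (borosMollWeight m _), ← Finset.mul_sum] at h
  rw [factorial_mul_d, factorial_mul_d, factorial_mul_d]
  field_simp
  linear_combination h

lemma d_pos {m i : ℕ} (h : i ≤ m) : 0 < d m i := by
  refine div_pos (Finset.sum_pos' (fun k _ => by positivity)
    ⟨m, Finset.self_mem_range_succ m, ?_⟩) (by positivity)
  have h1 : 0 < m.choose i := Nat.choose_pos h
  have h2 : 0 < (m + m).choose m := Nat.choose_pos (by omega)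
  simp only [Nat.sub_self, Nat.choose_self]
  positivity

lemma d_eq_zero {m i : ℕ} (h : m < i) : d m i = 0 := by
  rw [d, Finset.sum_eq_zero, zero_div]
  intro k hk
  rw [Nat.choose_eq_zero_of_lt (n := k) (k := i) (by have := Finset.mem_range.1 hk; omega), Nat.cast_zero, mul_zero]

lemma factorial_mul_d_succ_le {m j : ℕ} (h : j ≤ m) :
    ((j + 1).factorial : ℝ) * d m (j + 1) ≤ (m - j) * (j.factorial * d m j) := by
  induction h using Nat.decreasingInduction with
  | self => simp [d_eq_zero]
  | of_succ j hj ih =>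
    have hrec := factorial_mul_d_recurrence m j
    have hpos : 0 < ((j + 1).factorial : ℝ) * d m (j + 1) :=
      mul_pos (by positivity) (d_pos hj)
    push_cast at ih
    refine le_of_mul_le_mul_left (a := (m : ℝ) + j + 1) ?_ (by positivity)
    linarith

lemma factorial_mul_d_succ_lt {m j : ℕ} (h : j < m) :
    ((j + 1).factorial : ℝ) * d m (j + 1) < (m - j) * (j.factorial * d m j) := by
  have hrec := factorial_mul_d_recurrence m j
  have hle := factorial_mul_d_succ_le (m := m) (j := j + 1) h
  have hpos : 0 < ((j + 1).factorial : ℝ) * d m (j + 1) :=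
    mul_pos (by positivity) (d_pos h)
  push_cast at hle
  refine lt_of_mul_lt_mul_left (a := (m : ℝ) + j + 1) ?_ (by positivity)
  linarith

lemma factorial_mul_d_mul_lt_sq {m j : ℕ} (h : j < m) :
    (j.factorial * d m j) * ((j + 2).factorial * d m (j + 2)) <
      (((j + 1).factorial : ℝ) * d m (j + 1)) ^ 2 := by
  have hrec := factorial_mul_d_recurrence m j
  have hlt := factorial_mul_d_succ_lt h
  have hpos : 0 < (j.factorial : ℝ) * d m j := mul_pos (by positivity) (d_pos h.le)
  have hlt' : ((j + 1).factorial : ℝ) * d m (j + 1) < (m + j + 1) * (j.factorial * d m j) :=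
    hlt.trans_le (mul_le_mul_of_nonneg_right (by linarith [j.cast_nonneg (α := ℝ)]) hpos.le)
  rw [← eq_sub_iff_add_eq'] at hrec
  rw [hrec]
  linarith [mul_pos (sub_pos.2 hlt) (sub_pos.2 hlt')]

theorem boros_moll_factorial_log_concave (m i : ℕ) (hm : 2 ≤ m) (hi : 1 ≤ i)
    (hi' : i ≤ m - 1) :
    d m i ^ 2 / (d m (i - 1) * d m (i + 1)) > ((i : ℝ) + 1) / (i : ℝ) ∧
      ((Nat.factorial i : ℝ) * d m i) ^ 2 >
        ((Nat.factorial (i - 1) : ℝ) * d m (i - 1)) *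
          ((Nat.factorial (i + 1) : ℝ) * d m (i + 1)) := by
  obtain ⟨j, rfl⟩ : ∃ j, i = j + 1 := ⟨i - 1, by omega⟩
  have key := factorial_mul_d_mul_lt_sq (m := m) (j := j) (by omega)
  rw [Nat.add_sub_cancel]
  refine ⟨?_, key⟩
  have h0 : 0 < d m j := d_pos (by omega)
  have h2 : 0 < d m (j + 1 + 1) := d_pos (by omega)
  rw [gt_iff_lt, div_lt_div_iff₀ (by positivity) (by positivity)]
  have hf : 0 < (j.factorial : ℝ) := by positivity
  have hj : (0 : ℝ) < (j : ℝ) + 1 := by positivity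
  simp only [Nat.factorial_succ] at key
  push_cast at key ⊢
  refine lt_of_mul_lt_mul_left (a := (j.factorial : ℝ) ^ 2 * (j + 1)) ?_ (by positivity)
  linarith
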